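/- Let n ≥ 3 and let Ω ⊂ ℝⁿ be a bounded domain. Let u be a Dirichlet Laplace eigenfunction on Ω with eigenvalue λ > 0, u > 0 on Ω, u = 0 on ∂Ω, normalized so that sup_Ω u = 1. Then for every δ ∈ (0,1), the superlevel set V_δ = {x ∈ Ω : u(x) ≥ δ} satisfies Vol(V_δ) ≥ (1−δ)^{n/2} (2(n−2))^{n/2} αₙ λ^{−n/2}. -/

import Mathlib

open MeasureTheory Metric Real

/-- The Euclidean Laplacian of `u : ℝⁿ → ℝ`, as the sum of the second partial
derivatives in the coordinate directions. -/
noncomputable def euclLap (n : ℕ) (u : EuclideanSpace ℝ (Fin n) → ℝ)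
    (x : EuclideanSpace ℝ (Fin n)) : ℝ :=
  ∑ i : Fin n,
    fderiv ℝ (fun y => fderiv ℝ u y (EuclideanSpace.single i (1 : ℝ))) x
      (EuclideanSpace.single i (1 : ℝ))


open Set Filter Topology

/-- Green's second identity along a fixed direction, for a compactly supported first factor. -/
lemma integral_mul_fderiv_fderiv_comm {E : Type*} [NormedAddCommGroup E] [NormedSpace ℝ E]
    [FiniteDimensional ℝ E] [MeasurableSpace E] [BorelSpace E] {μ : Measure E}
    [μ.IsAddHaarMeasure] {F G : E → ℝ} (hF : ContDiff ℝ 2 F) (hFc : HasCompactSupport F)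
    (hG : ContDiff ℝ 2 G) (v : E) :
    Integrable (fun x => F x * fderiv ℝ (fun y => fderiv ℝ G y v) x v) μ ∧
    Integrable (fun x => fderiv ℝ (fun y => fderiv ℝ F y v) x v * G x) μ ∧
    ∫ x, F x * fderiv ℝ (fun y => fderiv ℝ G y v) x v ∂μ =
      ∫ x, fderiv ℝ (fun y => fderiv ℝ F y v) x v * G x ∂μ := by
  have hF1 : ContDiff ℝ 1 (fun y => fderiv ℝ F y v) :=
    (hF.fderiv_right (m := 1) (by norm_num)).clm_apply contDiff_const
  have hG1 : ContDiff ℝ 1 (fun y => fderiv ℝ G y v) :=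
    (hG.fderiv_right (m := 1) (by norm_num)).clm_apply contDiff_const
  have hF2 : Continuous (fun x => fderiv ℝ (fun y => fderiv ℝ F y v) x v) :=
    (hF1.continuous_fderiv one_ne_zero).clm_apply continuous_const
  have hG2 : Continuous (fun x => fderiv ℝ (fun y => fderiv ℝ G y v) x v) :=
    (hG1.continuous_fderiv one_ne_zero).clm_apply continuous_const
  have hFc1 : HasCompactSupport (fun y => fderiv ℝ F y v) := hFc.fderiv_apply ℝ v
  have hFc2 : HasCompactSupport (fun x => fderiv ℝ (fun y => fderiv ℝ F y v) x v) :=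
    hFc1.fderiv_apply ℝ v
  have I1 : Integrable (fun x => F x * fderiv ℝ (fun y => fderiv ℝ G y v) x v) μ :=
    (hF.continuous.mul hG2).integrable_of_hasCompactSupport hFc.mul_right
  have I2 : Integrable (fun x => fderiv ℝ F x v * fderiv ℝ G x v) μ :=
    (hF1.continuous.mul hG1.continuous).integrable_of_hasCompactSupport hFc1.mul_right
  have I3 : Integrable (fun x => fderiv ℝ (fun y => fderiv ℝ F y v) x v * G x) μ :=
    (hF2.mul hG.continuous).integrable_of_hasCompactSupport hFc2.mul_right
  have I4 : Integrable (fun x => F x * fderiv ℝ G x v) μ :=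
    (hF.continuous.mul hG1.continuous).integrable_of_hasCompactSupport hFc.mul_right
  have I5 : Integrable (fun x => fderiv ℝ F x v * G x) μ :=
    (hF1.continuous.mul hG.continuous).integrable_of_hasCompactSupport hFc1.mul_right
  refine ⟨I1, I3, ?_⟩
  rw [integral_mul_fderiv_eq_neg_fderiv_mul_of_integrable I2 I1 I4
    (fun x _ => (hF.differentiable two_ne_zero) x) (fun x _ => (hG1.differentiable one_ne_zero) x),
    integral_mul_fderiv_eq_neg_fderiv_mul_of_integrable I3 I2 I5
    (fun x _ => (hF1.differentiable one_ne_zero) x)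
    (fun x _ => (hG.differentiable two_ne_zero) x), neg_neg]

/-- Green's second identity for the Euclidean Laplacian. -/
lemma integral_mul_euclLap_comm {n : ℕ} {F G : EuclideanSpace ℝ (Fin n) → ℝ}
    (hF : ContDiff ℝ 2 F) (hFc : HasCompactSupport F) (hG : ContDiff ℝ 2 G) :
    Integrable (fun x => euclLap n F x * G x) ∧
    ∫ x, F x * euclLap n G x = ∫ x, euclLap n F x * G x := by
  have key := fun v => integral_mul_fderiv_fderiv_comm (μ := volume) hF hFc hG v
  simp only [euclLap, Finset.mul_sum, Finset.sum_mul]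
  refine ⟨integrable_finsetSum _ fun i _ => (key _).2.1, ?_⟩
  rw [integral_finsetSum _ fun i _ => (key _).1, integral_finsetSum _ fun i _ => (key _).2.1]
  exact Finset.sum_congr rfl fun i _ => (key _).2.2

lemma Filter.EventuallyEq.euclLap_eq {n : ℕ} {f g : EuclideanSpace ℝ (Fin n) → ℝ}
    {x : EuclideanSpace ℝ (Fin n)} (h : f =ᶠ[𝓝 x] g) : euclLap n f x = euclLap n g x := by
  refine Finset.sum_congr rfl fun i _ => ?_
  have : (fun y => fderiv ℝ f y (EuclideanSpace.single i (1 : ℝ))) =ᶠ[𝓝 x]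
      fun y => fderiv ℝ g y (EuclideanSpace.single i (1 : ℝ)) := by
    filter_upwards [h.fderiv (𝕜 := ℝ)] with y hy
    rw [hy]
  rw [this.fderiv_eq]

/-- Chain rule for the Euclidean Laplacian. -/
lemma euclLap_comp {n : ℕ} {h : ℝ → ℝ} {u : EuclideanSpace ℝ (Fin n) → ℝ}
    {x : EuclideanSpace ℝ (Fin n)} (hh : ContDiff ℝ 2 h) (hu : ContDiffAt ℝ 2 u x) :
    euclLap n (h ∘ u) x = deriv h (u x) * euclLap n u x +
      deriv (deriv h) (u x) *
        ∑ i : Fin n, (fderiv ℝ u x (EuclideanSpace.single i (1 : ℝ))) ^ 2 := by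
  simp only [euclLap, Finset.mul_sum, ← Finset.sum_add_distrib]
  refine Finset.sum_congr rfl fun i _ => ?_
  set v : EuclideanSpace ℝ (Fin n) := EuclideanSpace.single i (1 : ℝ)
  have hu' : ∀ᶠ y in 𝓝 x, DifferentiableAt ℝ u y := by
    filter_upwards [hu.eventually (by simp)] with y hy
    exact hy.differentiableAt two_ne_zero
  have e1 : (fun y => fderiv ℝ (h ∘ u) y v) =ᶠ[𝓝 x]
      fun y => (deriv h ∘ u) y * fderiv ℝ u y v := by
    filter_upwards [hu'] with y hy
    have := ((hh.differentiable two_ne_zero (u y)).hasDerivAt).comp_hasFDerivAt y hy.hasFDerivAt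
    rw [this.fderiv]
    simp
  have d1 : HasFDerivAt (deriv h ∘ u) (deriv (deriv h) (u x) • fderiv ℝ u x) x :=
    ((hh.differentiable_deriv_two (u x)).hasDerivAt).comp_hasFDerivAt x
      hu'.self_of_nhds.hasFDerivAt
  have d2 : DifferentiableAt ℝ (fun y => fderiv ℝ u y v) x :=
    ((hu.fderiv_right (m := 1) (by norm_num)).clm_apply contDiffAt_const).differentiableAt
      one_ne_zero
  have D : HasFDerivAt (fun y => (deriv h ∘ u) y * fderiv ℝ u y v) _ x := d1.mul d2.hasFDerivAt
  rw [e1.fderiv_eq, D.fderiv]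
  simp
  ring

/-- The Laplacian of a power of the regularized squared distance to a point. -/
lemma euclLap_norm_sub_sq_add_rpow {n : ℕ} (x₀ x : EuclideanSpace ℝ (Fin n)) {s : ℝ} (hs : 0 < s) :
    euclLap n (fun y => (‖y - x₀‖ ^ 2 + s) ^ (1 - (n : ℝ) / 2)) x =
      -(n * (n - 2)) * (s * (‖x - x₀‖ ^ 2 + s) ^ (-(n : ℝ) / 2 - 1)) := by
  have hw : ∀ y, 0 < ‖y - x₀‖ ^ 2 + s := fun y => by positivity
  have dw : ∀ y, HasFDerivAt (fun y => ‖y - x₀‖ ^ 2 + s) (2 • innerSL ℝ (y - x₀)) y := fun y => by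
    have := ((hasFDerivAt_id y).sub_const x₀).norm_sq.add_const s
    simpa using this
  have dp : ∀ (p : ℝ) y,
      HasFDerivAt (fun y => (‖y - x₀‖ ^ 2 + s) ^ p)
        ((p * (‖y - x₀‖ ^ 2 + s) ^ (p - 1)) • (2 • innerSL ℝ (y - x₀))) y :=
    fun p y => (dw y).rpow_const (Or.inl (hw y).ne')
  have hin : ∀ y (i : Fin n), (2 • innerSL ℝ (y - x₀)) (EuclideanSpace.single i (1 : ℝ)) =
      2 * (y i - x₀ i) := fun y i => by
    simp [EuclideanSpace.inner_single_right]
  have hsum : ∑ i, (x i - x₀ i) ^ 2 = ‖x - x₀‖ ^ 2 := by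
    simp [EuclideanSpace.norm_sq_eq]
  set p : ℝ := 1 - (n : ℝ) / 2 with hp
  have key : ∀ i : Fin n,
      fderiv ℝ (fun y => fderiv ℝ (fun y => (‖y - x₀‖ ^ 2 + s) ^ p) y
        (EuclideanSpace.single i (1 : ℝ))) x (EuclideanSpace.single i (1 : ℝ)) =
      2 * p * (‖x - x₀‖ ^ 2 + s) ^ (p - 1) +
        4 * p * (p - 1) * (‖x - x₀‖ ^ 2 + s) ^ (p - 1 - 1) * (x i - x₀ i) ^ 2 := by
    intro i
    have e : (fun y => fderiv ℝ (fun y => (‖y - x₀‖ ^ 2 + s) ^ p) y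
        (EuclideanSpace.single i (1 : ℝ))) =
        fun y => (p * (‖y - x₀‖ ^ 2 + s) ^ (p - 1)) * (2 * (y i - x₀ i)) := by
      funext y
      rw [(dp p y).fderiv, smul_apply, hin, smul_eq_mul]
    have d : HasFDerivAt (fun y : EuclideanSpace ℝ (Fin n) => 2 * (y i - x₀ i))
        ((2 : ℝ) • (EuclideanSpace.proj i : EuclideanSpace ℝ (Fin n) →L[ℝ] ℝ)) x :=
      (((EuclideanSpace.proj i : EuclideanSpace ℝ (Fin n) →L[ℝ] ℝ).hasFDerivAt).sub_const
        (x₀ i)).const_mul 2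
    have D : HasFDerivAt (fun y => (p * (‖y - x₀‖ ^ 2 + s) ^ (p - 1)) * (2 * (y i - x₀ i))) _ x :=
      ((dp (p - 1) x).const_mul p).mul d
    rw [e, D.fderiv]
    simp only [add_apply, smul_apply, hin]
    simp
    ring
  rw [euclLap, Finset.sum_congr rfl fun i _ => key i, Finset.sum_add_distrib, Finset.sum_const,
    ← Finset.mul_sum, hsum]
  have h1 : (‖x - x₀‖ ^ 2 + s) ^ (p - 1) =
      (‖x - x₀‖ ^ 2 + s) ^ (p - 1 - 1) * (‖x - x₀‖ ^ 2 + s) := by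
    rw [← Real.rpow_add_one (hw x).ne']; ring_nf
  have h2 : -(n : ℝ) / 2 - 1 = p - 1 - 1 := by rw [hp]; ring
  rw [h1, h2]
  simp only [Finset.card_univ, Fintype.card_fin, nsmul_eq_mul]
  have h3 : (n : ℝ) = 2 - 2 * p := by rw [hp]; ring
  rw [h3]
  ring

/-- A `C²` convex approximation of `t ↦ max (t - δ) 0` with slopes in `[0, 1]`. -/
lemma exists_contDiff_convex_cutoff (δ : ℝ) {a : ℝ} (ha : 0 < a) :
    ∃ h : ℝ → ℝ, ContDiff ℝ 2 h ∧ (∀ t ≤ δ, h t = 0) ∧ (∀ t ≤ δ, deriv h t = 0) ∧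
      (∀ t, 0 ≤ deriv h t) ∧ (∀ t, deriv h t ≤ 1) ∧ (∀ t, 0 ≤ deriv (deriv h) t) ∧
      ∀ t, t - δ - a ≤ h t := by
  let T : ℝ → ℝ := fun s => Real.smoothTransition ((s - δ) / a)
  have hT : ContDiff ℝ 1 T := Real.smoothTransition.contDiff.comp (by fun_prop)
  have hTm : Monotone T := fun s t hst => Real.smoothTransition.monotone (by gcongr)
  have hT0 : ∀ t ≤ δ, T t = 0 := fun t ht =>
    Real.smoothTransition.zero_of_nonpos (div_nonpos_of_nonpos_of_nonneg (by linarith) ha.le)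
  have hder : ∀ t, HasDerivAt (fun t => ∫ s in δ..t, T s) (T t) t := fun t =>
    hT.continuous.integral_hasStrictDerivAt δ t |>.hasDerivAt
  have hd : deriv (fun t => ∫ s in δ..t, T s) = T := funext fun t => (hder t).deriv
  refine ⟨fun t => ∫ s in δ..t, T s, ?_, ?_, ?_, ?_, ?_, ?_, ?_⟩
  · rw [show (2 : WithTop ℕ∞) = 1 + 1 from rfl]
    refine contDiff_succ_iff_deriv.2 ⟨fun t => (hder t).differentiableAt, by simp, ?_⟩
    rwa [hd]
  · intro t ht
    simp only
    rw [intervalIntegral.integral_congr (g := fun _ => (0 : ℝ))]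
    · simp
    · intro s hs
      rw [uIcc_of_ge ht] at hs
      exact hT0 s hs.2
  · simpa only [hd] using hT0
  · intro t; rw [hd]; exact Real.smoothTransition.nonneg _
  · intro t; rw [hd]; exact Real.smoothTransition.le_one _
  · intro t; rw [hd]; exact hTm.deriv_nonneg
  · intro t
    have hI : ∀ p q : ℝ, IntervalIntegrable T volume p q := fun p q =>
      hT.continuous.intervalIntegrable p q
    have h0 : ∀ p q : ℝ, p ≤ q → 0 ≤ ∫ s in p..q, T s := fun p q hpq =>
      intervalIntegral.integral_nonneg hpq fun s _ => Real.smoothTransition.nonneg _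
    simp only
    rcases le_total t (δ + a) with ht | ht
    · rcases le_total δ t with h | h
      · linarith [h0 δ t h]
      · have : ∫ s in δ..t, T s = 0 := by
          rw [intervalIntegral.integral_congr (g := fun _ => (0 : ℝ))]
          · simp
          · intro s hs
            rw [uIcc_of_ge h] at hs
            exact hT0 s hs.2
        linarith
    · rw [← intervalIntegral.integral_add_adjacent_intervals (hI δ (δ + a)) (hI (δ + a) t)]
      have : ∫ s in (δ + a)..t, T s = t - δ - a := by
        rw [intervalIntegral.integral_congr (g := fun _ => (1 : ℝ))]
        · simp; ring
        · intro s hs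
          rw [uIcc_of_le ht] at hs
          exact Real.smoothTransition.one_of_one_le ((one_le_div ha).2 (by linarith [hs.1]))
      linarith [h0 δ (δ + a) (by linarith)]

/-- The profile `(1 + ‖x‖²)^{-(n+2)/2}` has integral equal to the volume of the unit ball. -/
lemma integral_one_add_norm_sq_rpow {n : ℕ} (hn : 0 < n) :
    ∫ x : EuclideanSpace ℝ (Fin n), (1 + ‖x‖ ^ 2) ^ (-(n : ℝ) / 2 - 1) =
      volume.real (ball (0 : EuclideanSpace ℝ (Fin n)) 1) := by
  have : Nonempty (Fin n) := ⟨⟨0, hn⟩⟩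
  have hn' : (n : ℝ) ≠ 0 := by positivity
  rw [integral_fun_norm_addHaar volume (fun y : ℝ => (1 + y ^ 2) ^ (-(n : ℝ) / 2 - 1)),
    finrank_euclideanSpace_fin]
  have hw : ∀ y : ℝ, 0 < 1 + y ^ 2 := fun y => by positivity
  have hder : ∀ y ∈ Ici (0 : ℝ),
      HasDerivAt (fun y : ℝ => (n : ℝ)⁻¹ * (y ^ n * (1 + y ^ 2) ^ (-(n : ℝ) / 2)))
        (y ^ (n - 1) • (1 + y ^ 2) ^ (-(n : ℝ) / 2 - 1)) y := by
    intro y _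
    have h1 : HasDerivAt (fun y : ℝ => 1 + y ^ 2) (2 * y) y := by
      simpa using (hasDerivAt_pow 2 y).const_add 1
    have h2 := h1.rpow_const (p := -(n : ℝ) / 2) (Or.inl (hw y).ne')
    have h3 := ((hasDerivAt_pow n y).mul h2).const_mul (n : ℝ)⁻¹
    refine h3.congr_deriv ?_
    have h4 : (1 + y ^ 2) ^ (-(n : ℝ) / 2) = (1 + y ^ 2) ^ (-(n : ℝ) / 2 - 1) * (1 + y ^ 2) := by
      rw [← Real.rpow_add_one (hw y).ne']; ring_nf
    have h5 : y ^ n = y ^ (n - 1) * y := by rw [← pow_succ, Nat.sub_add_cancel hn]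
    rw [h4, h5, smul_eq_mul]
    field_simp
    ring
  have hlim : Tendsto (fun y : ℝ => (n : ℝ)⁻¹ * (y ^ n * (1 + y ^ 2) ^ (-(n : ℝ) / 2)))
      atTop (𝓝 ((n : ℝ)⁻¹ * 1)) := by
    refine Tendsto.const_mul _ ?_
    have h1 : Tendsto (fun y : ℝ => (1 + (y ^ 2)⁻¹) ^ (-(n : ℝ) / 2)) atTop (𝓝 1) := by
      have h2 : Tendsto (fun y : ℝ => 1 + (y ^ 2)⁻¹) atTop (𝓝 (1 + 0)) :=
        ((tendsto_pow_atTop two_ne_zero).inv_tendsto_atTop).const_add 1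
      have := h2.rpow_const (p := -(n : ℝ) / 2) (Or.inl (by norm_num))
      simpa using this
    refine h1.congr' ?_
    filter_upwards [Ioi_mem_atTop (0 : ℝ)] with y hy
    have hy : 0 < y := hy
    have h3 : 1 + y ^ 2 = y ^ 2 * (1 + (y ^ 2)⁻¹) := by field_simp; ring
    have h4 : y ^ n * (y ^ 2) ^ (-(n : ℝ) / 2) = 1 := by
      rw [← Real.rpow_natCast y 2, ← Real.rpow_mul hy.le, ← Real.rpow_natCast y n,
        ← Real.rpow_add hy]
      push_cast
      ring_nf
      simp
    rw [h3, Real.mul_rpow (by positivity) (by positivity), ← mul_assoc, h4, one_mul]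
  rw [integral_Ioi_of_hasDerivAt_of_nonneg' hder
    (fun y hy => by have : 0 < y := hy; rw [smul_eq_mul]; positivity) hlim]
  simp [hn.ne']
  field_simp

/-- Averages against the dilates of `(1 + ‖x‖²)^{-(n+2)/2}` concentrate at a point. -/
lemma tendsto_integral_one_add_norm_sq_rpow_mul {n : ℕ} (hn : 0 < n)
    {F : EuclideanSpace ℝ (Fin n) → ℝ} (hF : Integrable F) {x₀ : EuclideanSpace ℝ (Fin n)}
    (hF₀ : ContinuousAt F x₀) :
    Tendsto (fun c : ℝ => ∫ x, c ^ n * (1 + ‖c • (x₀ - x)‖ ^ 2) ^ (-(n : ℝ) / 2 - 1) * F x) atTop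
      (𝓝 (volume.real (ball (0 : EuclideanSpace ℝ (Fin n)) 1) * F x₀)) := by
  set A := volume.real (ball (0 : EuclideanSpace ℝ (Fin n)) 1) with hA
  have hA0 : 0 < A := ENNReal.toReal_pos (measure_ball_pos volume _ one_pos).ne'
    measure_ball_lt_top.ne
  have hdecay : Tendsto (fun x : EuclideanSpace ℝ (Fin n) =>
      ‖x‖ ^ Module.finrank ℝ (EuclideanSpace ℝ (Fin n)) *
        (A⁻¹ * (1 + ‖x‖ ^ 2) ^ (-(n : ℝ) / 2 - 1))) (Bornology.cobounded _) (𝓝 0) := by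
    have h1 : Tendsto (fun x : EuclideanSpace ℝ (Fin n) => A⁻¹ * (1 + ‖x‖ ^ 2)⁻¹)
        (Bornology.cobounded _) (𝓝 (A⁻¹ * 0)) :=
      ((tendsto_atTop_add_const_left _ 1 ((tendsto_pow_atTop two_ne_zero).comp
        tendsto_norm_cobounded_atTop)).inv_tendsto_atTop).const_mul _
    rw [mul_zero] at h1
    refine squeeze_zero (fun x => by positivity) (fun x => ?_) h1
    have hw : 0 < 1 + ‖x‖ ^ 2 := by positivity
    have h2 : ‖x‖ ^ n ≤ (1 + ‖x‖ ^ 2) ^ ((n : ℝ) / 2) := by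
      calc ‖x‖ ^ n = (‖x‖ ^ 2) ^ ((n : ℝ) / 2) := by
            rw [← Real.rpow_natCast ‖x‖ 2, ← Real.rpow_mul (norm_nonneg _), ← Real.rpow_natCast]
            push_cast
            ring_nf
        _ ≤ _ := by gcongr; linarith
    have h3 : (1 + ‖x‖ ^ 2) ^ (-(n : ℝ) / 2 - 1) =
        ((1 + ‖x‖ ^ 2) ^ ((n : ℝ) / 2))⁻¹ * (1 + ‖x‖ ^ 2)⁻¹ := by
      rw [Real.rpow_sub_one hw.ne', neg_div, Real.rpow_neg hw.le]; rfl
    have h4 : ‖x‖ ^ n * ((1 + ‖x‖ ^ 2) ^ ((n : ℝ) / 2))⁻¹ ≤ 1 := by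
      rw [← div_eq_mul_inv]; exact div_le_one_of_le₀ h2 (by positivity)
    rw [finrank_euclideanSpace_fin, h3]
    calc _ = (‖x‖ ^ n * ((1 + ‖x‖ ^ 2) ^ ((n : ℝ) / 2))⁻¹) * (A⁻¹ * (1 + ‖x‖ ^ 2)⁻¹) := by ring
      _ ≤ 1 * (A⁻¹ * (1 + ‖x‖ ^ 2)⁻¹) := by gcongr
      _ = _ := one_mul _
  have key := tendsto_integral_comp_smul_smul_of_integrable' (μ := volume)
    (φ := fun x : EuclideanSpace ℝ (Fin n) => A⁻¹ * (1 + ‖x‖ ^ 2) ^ (-(n : ℝ) / 2 - 1))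
    (fun x => by positivity)
    (by rw [integral_const_mul, integral_one_add_norm_sq_rpow hn, inv_mul_cancel₀ hA0.ne'])
    hdecay hF hF₀
  refine (key.const_mul A).congr fun c => ?_
  rw [← integral_const_mul, finrank_euclideanSpace_fin]
  refine integral_congr_ae (.of_forall fun x => ?_)
  simp only [smul_eq_mul]
  field_simp

/-- Bathtub principle: among sets of given measure, the integral of `g` is largest on a
superlevel set of `g`. -/
lemma setIntegral_le_setIntegral_of_measureReal_eq {X : Type*} [MeasurableSpace X] {μ : Measure X}
    {g : X → ℝ} {K B : Set X} {m : ℝ} (hK : MeasurableSet K) (hB : MeasurableSet B)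
    (hμK : μ K ≠ ⊤) (hμB : μ B ≠ ⊤) (hKB : μ.real K = μ.real B)
    (hgK : IntegrableOn g K μ) (hgB : IntegrableOn g B μ)
    (hBm : ∀ x ∈ B, m ≤ g x) (hBc : ∀ x ∉ B, g x ≤ m) :
    ∫ x in K, g x ∂μ ≤ ∫ x in B, g x ∂μ := by
  have iK : IntegrableOn (fun x => g x - m) K μ := hgK.sub (integrableOn_const hμK)
  have iB : IntegrableOn (fun x => g x - m) B μ := hgB.sub (integrableOn_const hμB)
  have h : ∫ x in K, (g x - m) ∂μ ≤ ∫ x in B, (g x - m) ∂μ := by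
    rw [← integral_indicator hK, ← integral_indicator hB]
    refine integral_mono (iK.integrable_indicator hK) (iB.integrable_indicator hB) fun x => ?_
    by_cases h1 : x ∈ K <;> by_cases h2 : x ∈ B <;>
      simp only [indicator_of_mem, indicator_of_notMem, h1, h2, not_false_eq_true, le_refl]
    · linarith [hBc x h2]
    · linarith [hBm x h2]
  rw [integral_sub hgK (integrableOn_const hμK), integral_sub hgB (integrableOn_const hμB),
    setIntegral_const, setIntegral_const, hKB] at h
  linarith

/-- The integral over a centred ball of the regularized Newtonian kernel. -/
lemma setIntegral_ball_norm_sq_add_rpow_le {n : ℕ} (hn : 2 ≤ n)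
    (x₀ : EuclideanSpace ℝ (Fin n)) {s R : ℝ} (hs : 0 < s) (hR : 0 ≤ R) :
    ∫ x in ball x₀ R, (‖x - x₀‖ ^ 2 + s) ^ (1 - (n : ℝ) / 2) ≤
      n * volume.real (ball (0 : EuclideanSpace ℝ (Fin n)) 1) * (R ^ 2 / 2) := by
  have : Nonempty (Fin n) := ⟨⟨0, by omega⟩⟩
  let f : ℝ → ℝ := (Iio R).indicator fun y => (y ^ 2 + s) ^ (1 - (n : ℝ) / 2)
  have h1 : ∫ x in ball x₀ R, (‖x - x₀‖ ^ 2 + s) ^ (1 - (n : ℝ) / 2) = ∫ x, f ‖x - x₀‖ := by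
    rw [← integral_indicator measurableSet_ball]
    refine integral_congr_ae (.of_forall fun x => ?_)
    simp [f, indicator, dist_eq_norm]
  have h2 : ∫ x, f ‖x - x₀‖ = ∫ x : EuclideanSpace ℝ (Fin n), f ‖x‖ :=
    integral_sub_right_eq_self (fun x => f ‖x‖) x₀
  rw [h1, h2, integral_fun_norm_addHaar volume f, finrank_euclideanSpace_fin, nsmul_eq_mul,
    smul_eq_mul, mul_assoc]
  gcongr
  have hI : ∫ y in Ioi (0 : ℝ), (Iio R).indicator (fun y => y) y = R ^ 2 / 2 := by
    rw [setIntegral_indicator measurableSet_Iio, Ioi_inter_Iio, ← integral_Ioc_eq_integral_Ioo,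
      ← intervalIntegral.integral_of_le hR, integral_id]
    ring
  have hint : IntegrableOn ((Iio R).indicator fun y : ℝ => y) (Ioi 0) := by
    rw [IntegrableOn, integrable_indicator_iff measurableSet_Iio, IntegrableOn,
      Measure.restrict_restrict measurableSet_Iio, Iio_inter_Ioi]
    exact (continuous_id.integrableOn_Icc (a := 0) (b := R)).mono_set Ioo_subset_Icc_self
  rw [← hI]
  refine integral_mono_of_nonneg ?_ hint ?_
  · filter_upwards [ae_restrict_mem measurableSet_Ioi] with y hy
    have hy : 0 < y := hy
    exact smul_nonneg (by positivity) (indicator_nonneg (fun y _ => by positivity) _)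
  · filter_upwards [ae_restrict_mem measurableSet_Ioi] with y hy
    have hy : 0 < y := hy
    by_cases h : y ∈ Iio R
    · simp only [f, indicator_of_mem h, smul_eq_mul]
      have hn' : (2 : ℝ) ≤ n := by exact_mod_cast hn
      calc y ^ (n - 1) * (y ^ 2 + s) ^ (1 - (n : ℝ) / 2)
          ≤ y ^ (n - 1) * (y ^ 2) ^ (1 - (n : ℝ) / 2) := by
            gcongr y ^ (n - 1) * ?_
            exact Real.rpow_le_rpow_of_nonpos (by positivity) (by linarith) (by linarith)
        _ = y := by
            rw [← Real.rpow_natCast y 2, ← Real.rpow_mul hy.le, ← Real.rpow_natCast y (n - 1),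
              ← Real.rpow_add hy, Nat.cast_sub (by omega)]
            push_cast
            ring_nf
            simp
    · simp [f, indicator_of_notMem h]

/-- A compactly supported `C²` function with `-Δ F ≤ lam` on `K` and `-Δ F ≤ 0` elsewhere is
bounded by the Newtonian potential of a ball with the same volume as `K`, at its centre. -/
lemma two_mul_sub_two_mul_le_of_neg_euclLap_le {n : ℕ} (hn : 3 ≤ n)
    {F : EuclideanSpace ℝ (Fin n) → ℝ} (hF : ContDiff ℝ 2 F) (hFc : HasCompactSupport F)
    {K : Set (EuclideanSpace ℝ (Fin n))} (hK : IsCompact K) {lam R : ℝ} (hlam : 0 ≤ lam)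
    (hR : 0 ≤ R) (hFK : ∀ x, -euclLap n F x ≤ K.indicator (fun _ => lam) x)
    (hKR : volume.real K = volume.real (ball (0 : EuclideanSpace ℝ (Fin n)) R))
    (x₀ : EuclideanSpace ℝ (Fin n)) :
    2 * ((n : ℝ) - 2) * F x₀ ≤ lam * R ^ 2 := by
  have hn' : (3 : ℝ) ≤ n := by exact_mod_cast hn
  set A := volume.real (ball (0 : EuclideanSpace ℝ (Fin n)) 1) with hA
  have hA0 : 0 < A := ENNReal.toReal_pos (measure_ball_pos volume _ one_pos).ne'
    measure_ball_lt_top.ne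
  have hlim := (tendsto_integral_one_add_norm_sq_rpow_mul (by omega : 0 < n)
    (hF.continuous.integrable_of_hasCompactSupport hFc)
    (hF.continuous.continuousAt (x := x₀))).const_mul (n * ((n : ℝ) - 2))
  suffices h : n * ((n : ℝ) - 2) * (A * F x₀) ≤ lam * (n * A * (R ^ 2 / 2)) by
    have h2 : 0 < n * A := by positivity
    refine le_of_mul_le_mul_left ?_ h2
    linarith
  refine le_of_tendsto hlim ?_
  filter_upwards [Ioi_mem_atTop (0 : ℝ)] with c hc
  have hc : 0 < c := hc
  set s : ℝ := (c ^ 2)⁻¹ with hs_def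
  have hs : 0 < s := by positivity
  set G : EuclideanSpace ℝ (Fin n) → ℝ :=
    fun y => (‖y - x₀‖ ^ 2 + s) ^ (1 - (n : ℝ) / 2) with hG_def
  have hw : ∀ y, 0 < ‖y - x₀‖ ^ 2 + s := fun y => by positivity
  have hG : ContDiff ℝ 2 G :=
    (((contDiff_id.sub contDiff_const).norm_sq ℝ).add contDiff_const).rpow_const_of_ne
      fun y => (hw y).ne'
  have hG0 : ∀ y, 0 ≤ G y := fun y => Real.rpow_nonneg (hw y).le _
  have hscale : ∀ x, n * ((n : ℝ) - 2) *
      (c ^ n * (1 + ‖c • (x₀ - x)‖ ^ 2) ^ (-(n : ℝ) / 2 - 1) * F x) =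
        -(F x * euclLap n G x) := by
    intro x
    have h1 : ‖x - x₀‖ ^ 2 + s = s * (1 + ‖c • (x₀ - x)‖ ^ 2) := by
      rw [norm_smul, mul_pow, norm_sub_rev x₀ x, Real.norm_of_nonneg hc.le, hs_def]
      field_simp
      ring
    have h2 : s * s ^ (-(n : ℝ) / 2 - 1) = c ^ n := by
      rw [mul_comm, ← Real.rpow_add_one hs.ne', hs_def, ← Real.rpow_natCast c 2,
        ← Real.rpow_neg hc.le, ← Real.rpow_mul hc.le, ← Real.rpow_natCast c n]
      congr 1
      push_cast
      ring
    rw [hG_def, euclLap_norm_sub_sq_add_rpow x₀ x hs, h1, Real.mul_rpow hs.le (by positivity),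
      ← h2]
    ring
  obtain ⟨hint, hgreen⟩ := integral_mul_euclLap_comm hF hFc hG
  have hGK : IntegrableOn G K := hG.continuous.continuousOn.integrableOn_compact hK
  have hGB : IntegrableOn G (ball x₀ R) :=
    (hG.continuous.continuousOn.integrableOn_compact (isCompact_closedBall x₀ R)).mono_set
      ball_subset_closedBall
  calc n * ((n : ℝ) - 2) *
        ∫ x, c ^ n * (1 + ‖c • (x₀ - x)‖ ^ 2) ^ (-(n : ℝ) / 2 - 1) * F x
      = ∫ x, -(euclLap n F x * G x) := by
        rw [← integral_const_mul, integral_congr_ae (.of_forall hscale), integral_neg, hgreen,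
          integral_neg]
    _ ≤ ∫ x, K.indicator (fun x => lam * G x) x := by
        refine integral_mono hint.neg (IntegrableOn.integrable_indicator (hGK.const_mul lam) hK.measurableSet)
          fun x => ?_
        have h := mul_le_mul_of_nonneg_right (hFK x) (hG0 x)
        by_cases hx : x ∈ K <;> simp only [indicator, hx, if_true, if_false] at h ⊢ <;> linarith
    _ = lam * ∫ x in K, G x := by
        rw [integral_indicator hK.measurableSet, integral_const_mul]
    _ ≤ lam * ∫ x in ball x₀ R, G x := by
        refine mul_le_mul_of_nonneg_left (setIntegral_le_setIntegral_of_measureReal_eq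
          (m := (R ^ 2 + s) ^ (1 - (n : ℝ) / 2)) hK.measurableSet
          measurableSet_ball hK.measure_lt_top.ne measure_ball_lt_top.ne ?_ hGK hGB ?_ ?_) hlam
        · rw [hKR, Measure.addHaar_real_ball_center volume x₀]
        · intro x hx
          rw [mem_ball, dist_eq_norm] at hx
          exact Real.rpow_le_rpow_of_nonpos (hw x) (by gcongr) (by linarith)
        · intro x hx
          rw [mem_ball, dist_eq_norm, not_lt] at hx
          exact Real.rpow_le_rpow_of_nonpos (by positivity) (by gcongr) (by linarith)
    _ ≤ lam * (n * A * (R ^ 2 / 2)) := by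
        gcongr
        exact setIntegral_ball_norm_sq_add_rpow_le (by omega) x₀ hs hR

/-- Volume lower bound for superlevel sets of a positive Dirichlet eigenfunction
on a bounded domain `Ω ⊂ ℝⁿ`, `n ≥ 3`, normalized with `sup_Ω u = 1`:
`Vol{u ≥ δ} ≥ (1-δ)^{n/2} (2(n-2))^{n/2} αₙ λ^{-n/2}`. -/
theorem superlevel_volume_lower_bound
    (n : ℕ) (hn : 3 ≤ n)
    (Ω : Set (EuclideanSpace ℝ (Fin n)))
    (hΩopen : IsOpen Ω) (hΩbd : Bornology.IsBounded Ω) (hΩconn : IsConnected Ω)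
    (α : ℝ) (hα : α = (volume (ball (0 : EuclideanSpace ℝ (Fin n)) 1)).toReal)
    (u : EuclideanSpace ℝ (Fin n) → ℝ) (lam : ℝ) (hlam : 0 < lam)
    (hcont : ContinuousOn u (closure Ω))
    (hsmooth : ∀ x ∈ Ω, ContDiffAt ℝ 2 u x)
    (heig : ∀ x ∈ Ω, euclLap n u x = -lam * u x)
    (hpos : ∀ x ∈ Ω, 0 < u x)
    (hbdry : ∀ x ∈ frontier Ω, u x = 0)
    (hsup : sSup (u '' Ω) = 1)
    (δ : ℝ) (hδ0 : 0 < δ) (hδ1 : δ < 1) :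
    ENNReal.ofReal
        ((1 - δ) ^ ((n : ℝ) / 2) * (2 * ((n : ℝ) - 2)) ^ ((n : ℝ) / 2) * α *
          lam ^ (-(n : ℝ) / 2)) ≤
      volume {x ∈ Ω | δ ≤ u x} := by
  have hn' : (3 : ℝ) ≤ n := by exact_mod_cast hn
  have hn0 : (n : ℝ) ≠ 0 := by linarith
  have : Nonempty (Fin n) := ⟨⟨0, by omega⟩⟩
  have hα0 : 0 < α := by
    rw [hα]
    exact ENNReal.toReal_pos (measure_ball_pos volume _ one_pos).ne' measure_ball_lt_top.ne
  have hcpt : IsCompact (closure Ω) := hΩbd.isCompact_closure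
  have hle : ∀ x ∈ Ω, u x ≤ 1 := fun x hx => by
    rw [← hsup]
    exact le_csSup ((hcpt.bddAbove_image hcont).mono (image_mono subset_closure))
      (mem_image_of_mem u hx)
  obtain ⟨x₀, hx₀, hux₀⟩ : ∃ x₀ ∈ Ω, u x₀ = 1 := by
    obtain ⟨z, hz⟩ := hΩconn.nonempty
    obtain ⟨x₀, hx₀, hmax⟩ := hcpt.exists_isMaxOn ⟨z, subset_closure hz⟩ hcont
    have hmax : ∀ y ∈ closure Ω, u y ≤ u x₀ := hmax
    have hx₀Ω : x₀ ∈ Ω := by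
      by_contra h
      have := hbdry x₀ (by rw [hΩopen.frontier_eq]; exact ⟨hx₀, h⟩)
      linarith [hmax z (subset_closure hz), hpos z hz]
    refine ⟨x₀, hx₀Ω, le_antisymm (hle x₀ hx₀Ω) ?_⟩
    rw [← hsup]
    refine csSup_le ⟨u z, mem_image_of_mem u hz⟩ ?_
    rintro _ ⟨y, hy, rfl⟩
    exact hmax y (subset_closure hy)
  set K : Set (EuclideanSpace ℝ (Fin n)) := {x ∈ Ω | δ ≤ u x} with hK_def
  have hK : IsCompact K := by
    have : K = closure Ω ∩ u ⁻¹' Ici δ := by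
      ext x
      refine ⟨fun hx => ⟨subset_closure hx.1, hx.2⟩, fun hx => ⟨?_, hx.2⟩⟩
      by_contra h
      have h0 := hbdry x (by rw [hΩopen.frontier_eq]; exact ⟨hx.1, h⟩)
      have h1 : δ ≤ u x := hx.2
      linarith
    rw [this]
    exact hcpt.of_isClosed_subset (hcont.preimage_isClosed_of_isClosed isClosed_closure isClosed_Ici)
      inter_subset_left
  set R : ℝ := (volume.real K / α) ^ (n : ℝ)⁻¹ with hR_def
  have hR : 0 ≤ R := by positivity
  have hRn : R ^ n = volume.real K / α := Real.rpow_inv_natCast_pow (by positivity) (by omega)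
  have hKR : volume.real K = volume.real (ball (0 : EuclideanSpace ℝ (Fin n)) R) := by
    rw [measureReal_def volume (ball _ _), Measure.addHaar_ball volume 0 hR, ENNReal.toReal_mul,
      ENNReal.toReal_ofReal (by positivity), finrank_euclideanSpace_fin, hRn, ← hα,
      div_mul_cancel₀ _ hα0.ne']
  have hbound : 2 * ((n : ℝ) - 2) * (1 - δ) ≤ lam * R ^ 2 := by
    have happrox : ∀ a > 0, 2 * ((n : ℝ) - 2) * (1 - δ - a) ≤ lam * R ^ 2 := by
      intro a ha
      obtain ⟨h, hh, h0, hd0, hd_nonneg, hd_le, hdd, hlow⟩ := exists_contDiff_convex_cutoff δ ha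
      set F : EuclideanSpace ℝ (Fin n) → ℝ := Ω.indicator (h ∘ u) with hF_def
      have hFΩ : ∀ x ∈ Ω, F =ᶠ[𝓝 x] h ∘ u := fun x hx => by
        filter_upwards [hΩopen.mem_nhds hx] with y hy
        exact indicator_of_mem hy _
      have hF0 : ∀ x ∉ K, F x = 0 := fun x hx => by
        by_cases hxΩ : x ∈ Ω
        · rw [hF_def, indicator_of_mem hxΩ]
          exact h0 _ (not_le.1 fun h' => hx ⟨hxΩ, h'⟩).le
        · exact indicator_of_notMem hxΩ _
      have hFKc : ∀ x ∉ K, F =ᶠ[𝓝 x] fun _ => 0 := fun x hx => by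
        filter_upwards [hK.isClosed.isOpen_compl.mem_nhds hx] with y hy
        exact hF0 y hy
      have hF : ContDiff ℝ 2 F := contDiff_iff_contDiffAt.2 fun x => by
        by_cases hx : x ∈ K
        · exact (hh.contDiffAt.comp x (hsmooth x hx.1)).congr_of_eventuallyEq (hFΩ x hx.1)
        · exact contDiffAt_const.congr_of_eventuallyEq (hFKc x hx)
      have hFlap : ∀ x, -euclLap n F x ≤ K.indicator (fun _ => lam) x := fun x => by
        by_cases hx : x ∈ K
        · rw [indicator_of_mem hx, (hFΩ x hx.1).euclLap_eq, euclLap_comp hh (hsmooth x hx.1),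
            heig x hx.1]
          have h1 : 0 ≤ deriv (deriv h) (u x) *
              ∑ i : Fin n, (fderiv ℝ u x (EuclideanSpace.single i (1 : ℝ))) ^ 2 :=
            mul_nonneg (hdd _) (Finset.sum_nonneg fun i _ => sq_nonneg _)
          have h2 : deriv h (u x) * u x ≤ 1 :=
            mul_le_one₀ (hd_le _) (hpos x hx.1).le (hle x hx.1)
          nlinarith
        · rw [indicator_of_notMem hx, (hFKc x hx).euclLap_eq]
          simp [euclLap]
      have hmain := two_mul_sub_two_mul_le_of_neg_euclLap_le hn hF
        (HasCompactSupport.intro hK hF0) hK hlam.le hR hFlap hKR x₀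
      have hFx₀ : F x₀ = h 1 := by rw [hF_def, indicator_of_mem hx₀, Function.comp, hux₀]
      rw [hFx₀] at hmain
      refine le_trans ?_ hmain
      have : 0 ≤ 2 * ((n : ℝ) - 2) := by linarith
      gcongr
      exact hlow 1
    have hlim : Tendsto (fun a : ℝ => 2 * ((n : ℝ) - 2) * (1 - δ - a)) (𝓝[>] 0)
        (𝓝 (2 * ((n : ℝ) - 2) * (1 - δ - 0))) :=
      (Continuous.tendsto (by fun_prop) 0).mono_left nhdsWithin_le_nhds
    rw [sub_zero] at hlim
    exact le_of_tendsto hlim (by filter_upwards [self_mem_nhdsWithin] with a ha using happrox a ha)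
  rw [ENNReal.ofReal_le_iff_le_toReal hK.measure_lt_top.ne, ← measureReal_def]
  have h1 : 0 ≤ 1 - δ := by linarith
  have h2 : 0 ≤ 2 * ((n : ℝ) - 2) := by linarith
  have hpow : ((1 - δ) * (2 * ((n : ℝ) - 2)) * lam⁻¹) ^ ((n : ℝ) / 2) ≤ volume.real K / α := by
    calc ((1 - δ) * (2 * ((n : ℝ) - 2)) * lam⁻¹) ^ ((n : ℝ) / 2)
        ≤ (R ^ 2) ^ ((n : ℝ) / 2) := by
          gcongr
          rw [← div_eq_mul_inv, div_le_iff₀ hlam]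
          linarith
      _ = volume.real K / α := by
          rw [← hRn, ← Real.rpow_natCast R 2, ← Real.rpow_mul hR, ← Real.rpow_natCast R n]
          congr 1
          push_cast
          ring
  rw [Real.mul_rpow (by positivity) (by positivity), Real.mul_rpow h1 h2,
    Real.inv_rpow hlam.le, ← Real.rpow_neg hlam.le, ← neg_div, le_div_iff₀ hα0] at hpow
  linarith
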